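/- Fix d = 2. For every viscosity ν > 0, resistivity η > 0, and constants T > 0, M > 0, there exist a smooth divergence-free vector field b₀ : 𝕋² → ℝ² with zero average and ‖b₀‖_{L²} = M, and a global smooth solution (u, b, P) of the MHD system on 𝕋² with initial datum (u(0,·), b(0,·)) = (0, b₀), such that u(t,·) and b(t,·) have zero average for all t ≥ 0 and the magnetic lines of b(0,·) and of b(T,·) are not topologically equivalent: there is no homeomorphism of 𝕋² onto itself mapping the family of magnetic lines of b(0,·) onto the family of magnetic lines of b(T,·). -/

import Mathlib

open MeasureTheory Real Set

noncomputable section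

/-- Partial derivative of a scalar function on `ℝ^d` in the `i`-th coordinate direction. -/
def pd {d : ℕ} (i : Fin d) (f : (Fin d → ℝ) → ℝ) : (Fin d → ℝ) → ℝ :=
  fun x => fderiv ℝ f x (Pi.single i 1)

/-- Iterated partial derivative along a list of directions. -/
def pdList {d : ℕ} : List (Fin d) → ((Fin d → ℝ) → ℝ) → ((Fin d → ℝ) → ℝ)
  | [], f => f
  | i :: l, f => pd i (pdList l f)

/-- The list of directions associated to a multi-index `α`
(the direction `i` repeated `α i` times). -/
def mIdxList {d : ℕ} (α : Fin d → ℕ) : List (Fin d) :=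
  ((List.finRange d).map fun i => List.replicate (α i) i).flatten

/-- The partial derivative `∂^α f` for a multi-index `α`. -/
def pdM {d : ℕ} (α : Fin d → ℕ) (f : (Fin d → ℝ) → ℝ) : (Fin d → ℝ) → ℝ :=
  pdList (mIdxList α) f

/-- `|∇^m w|²(x) = ∑_{|α| = m} |∂^α w(x)|²` for a vector field `w : ℝ^d → ℝ^k`. -/
def gradSq {d k : ℕ} (m : ℕ) (w : (Fin d → ℝ) → Fin k → ℝ) (x : Fin d → ℝ) : ℝ :=
  ∑ α ∈ Finset.Nat.antidiagonalTuple d m, ∑ i, pdM α (fun y => w y i) x ^ 2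

/-- The fundamental domain `[0,L]^d` of the torus `ℝ^d/(Lℤ)^d`. -/
def box (d : ℕ) (L : ℝ) : Set (Fin d → ℝ) := Set.Icc 0 fun _ => L

/-- Square of the Sobolev `H^r` norm on the torus of period `L`. -/
def HnormSq {d k : ℕ} (L : ℝ) (r : ℕ) (w : (Fin d → ℝ) → Fin k → ℝ) : ℝ :=
  ∑ m ∈ Finset.range (r + 1), ∫ x in box d L, gradSq m w x

/-- The Sobolev `H^r` norm on the torus of period `L`. -/
def Hnorm {d k : ℕ} (L : ℝ) (r : ℕ) (w : (Fin d → ℝ) → Fin k → ℝ) : ℝ :=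
  Real.sqrt (HnormSq L r w)

/-- The `L²` norm on the torus of period `L`. -/
def L2norm {d k : ℕ} (L : ℝ) (w : (Fin d → ℝ) → Fin k → ℝ) : ℝ :=
  Real.sqrt (∫ x in box d L, ∑ i, w x i ^ 2)

/-- The `L^∞` norm of `∇^m w`. -/
def LinfGrad {d k : ℕ} (m : ℕ) (w : (Fin d → ℝ) → Fin k → ℝ) : ℝ :=
  ⨆ x : Fin d → ℝ, Real.sqrt (gradSq m w x)

/-- The `L^∞` norm of `w`. -/
def Linf {d k : ℕ} (w : (Fin d → ℝ) → Fin k → ℝ) : ℝ := LinfGrad 0 w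

/-- `L`-periodicity in each coordinate direction. -/
def Prdc {d : ℕ} {E : Type*} (L : ℝ) (w : (Fin d → ℝ) → E) : Prop :=
  ∀ (x : Fin d → ℝ) (i : Fin d), w (x + Pi.single i L) = w x

/-- Zero average on the torus. -/
def ZeroAvg {d k : ℕ} (L : ℝ) (w : (Fin d → ℝ) → Fin k → ℝ) : Prop :=
  ∀ i, (∫ x in box d L, w x i) = 0

/-- Divergence of a vector field on `ℝ^d`. -/
def divg {d : ℕ} (w : (Fin d → ℝ) → Fin d → ℝ) (x : Fin d → ℝ) : ℝ :=
  ∑ i, pd i (fun y => w y i) x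

/-- A smooth solution of the MHD system with viscosity `ν` and resistivity `η` on the torus
`ℝ^d/(Lℤ)^d`, on the time interval `J` (the equations are imposed at positive times of `J`). -/
structure IsMHD (d : ℕ) (L ν η : ℝ) (J : Set ℝ)
    (u b : ℝ → (Fin d → ℝ) → Fin d → ℝ) (P : ℝ → (Fin d → ℝ) → ℝ) : Prop where
  smooth_u : ContDiffOn ℝ (⊤ : ℕ∞) (fun p : ℝ × (Fin d → ℝ) => u p.1 p.2) (J ×ˢ Set.univ)
  smooth_b : ContDiffOn ℝ (⊤ : ℕ∞) (fun p : ℝ × (Fin d → ℝ) => b p.1 p.2) (J ×ˢ Set.univ)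
  smooth_P : ContDiffOn ℝ (⊤ : ℕ∞) (fun p : ℝ × (Fin d → ℝ) => P p.1 p.2) (J ×ˢ Set.univ)
  periodic_u : ∀ t ∈ J, Prdc L (u t)
  periodic_b : ∀ t ∈ J, Prdc L (b t)
  periodic_P : ∀ t ∈ J, Prdc L (P t)
  div_u : ∀ t ∈ J, ∀ x, divg (u t) x = 0
  div_b : ∀ t ∈ J, ∀ x, divg (b t) x = 0
  momentum : ∀ t ∈ J, 0 < t → ∀ x i,
    deriv (fun s => u s x i) t + (∑ j, u t x j * pd j (fun y => u t y i) x) + pd i (P t) x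
      = ν * (∑ j, pd j (pd j fun y => u t y i) x) + ∑ j, b t x j * pd j (fun y => b t y i) x
  induction_eq : ∀ t ∈ J, 0 < t → ∀ x i,
    deriv (fun s => b s x i) t + (∑ j, u t x j * pd j (fun y => b t y i) x)
      = (∑ j, b t x j * pd j (fun y => u t y i) x)
        + η * (∑ j, pd j (pd j fun y => b t y i) x)

/-- Projection from `ℝ^d` onto the torus `ℝ^d/(Lℤ)^d`. -/
def torusProj (d : ℕ) (L : ℝ) (x : Fin d → ℝ) : Fin d → AddCircle L :=
  fun i => (x i : AddCircle L)

/-- A magnetic line of the field `b`: the image on the torus of a maximal (hence, since the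
relevant fields are smooth and periodic, globally defined) integral curve of `b`. -/
def IsMagLine (d : ℕ) (L : ℝ) (b : (Fin d → ℝ) → Fin d → ℝ)
    (s : Set (Fin d → AddCircle L)) : Prop :=
  ∃ γ : ℝ → Fin d → ℝ, (∀ τ : ℝ, HasDerivAt γ (b (γ τ)) τ) ∧
    s = torusProj d L '' Set.range γ

/-- The families of magnetic lines of `b₁` and `b₂` are topologically equivalent: some
self-homeomorphism of the torus maps the family of magnetic lines of `b₁` bijectively onto the
family of magnetic lines of `b₂`. -/
def MagLinesEquiv (d : ℕ) (L : ℝ) (b₁ b₂ : (Fin d → ℝ) → Fin d → ℝ) : Prop :=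
  ∃ φ : (Fin d → AddCircle L) ≃ₜ (Fin d → AddCircle L),
    ∀ s : Set (Fin d → AddCircle L), IsMagLine d L b₁ s ↔ IsMagLine d L b₂ (φ '' s)


/-- The vertical shear field on the plane with profile `h`. -/
def shear (h : ℝ → ℝ) (x : Fin 2 → ℝ) : Fin 2 → ℝ := ![0, h (x 0)]

/-- A decaying superposition of the first two sine modes; for `μ = 4 * π ^ 2 * η` it solves the
one-dimensional heat equation with diffusivity `η`. The second mode is normalised so that the profile degenerates
at time `T`. -/
def heatProfile (A μ T t s : ℝ) : ℝ :=
  A * (exp (-(μ * t)) * sin (2 * π * s)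
    + exp (3 * μ * T) / 2 * exp (-(4 * μ * t)) * sin (4 * π * s))

lemma pd_comp_zero {h : ℝ → ℝ} (hh : Differentiable ℝ h) :
    pd (d := 2) 0 (fun y => h (y 0)) = fun y => deriv h (y 0) := by
  funext x
  have h1 : HasFDerivAt (fun y : Fin 2 → ℝ => y 0)
      (ContinuousLinearMap.proj (R := ℝ) (φ := fun _ : Fin 2 => ℝ) 0) x :=
    (ContinuousLinearMap.proj (R := ℝ) (φ := fun _ : Fin 2 => ℝ) 0).hasFDerivAt
  have h2 := (hh (x 0)).hasDerivAt.comp_hasFDerivAt x h1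
  simp only [pd]
  rw [show (fun y : Fin 2 → ℝ => h (y 0)) = h ∘ fun y : Fin 2 → ℝ => y 0 from rfl, h2.fderiv]
  simp

lemma pd_comp_one {h : ℝ → ℝ} (hh : Differentiable ℝ h) :
    pd (d := 2) 1 (fun y => h (y 0)) = fun _ => 0 := by
  funext x
  have h1 : HasFDerivAt (fun y : Fin 2 → ℝ => y 0)
      (ContinuousLinearMap.proj (R := ℝ) (φ := fun _ : Fin 2 => ℝ) 0) x :=
    (ContinuousLinearMap.proj (R := ℝ) (φ := fun _ : Fin 2 => ℝ) 0).hasFDerivAt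
  have h2 := (hh (x 0)).hasDerivAt.comp_hasFDerivAt x h1
  simp only [pd]
  rw [show (fun y : Fin 2 → ℝ => h (y 0)) = h ∘ fun y : Fin 2 → ℝ => y 0 from rfl, h2.fderiv]
  simp

lemma pd_const {d : ℕ} (i : Fin d) (c : ℝ) : pd i (fun _ => c) = fun _ => 0 := by
  funext x
  simp [pd]

lemma integral_box_comp_zero (f : ℝ → ℝ) :
    ∫ x in box 2 1, f (x 0) = ∫ s in (0 : ℝ)..1, f s := by
  have hmp := volume_preserving_finTwoArrow ℝ
  have hbox : box 2 1 = MeasurableEquiv.finTwoArrow ⁻¹' (Icc (0 : ℝ) 1 ×ˢ Icc (0 : ℝ) 1) := by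
    ext x
    simp [box, Set.mem_Icc, Pi.le_def, Fin.forall_fin_two, MeasurableEquiv.finTwoArrow]
  have hpre := hmp.setIntegral_preimage_emb (MeasurableEquiv.measurableEmbedding _)
    (fun p : ℝ × ℝ => f p.1) (Icc (0 : ℝ) 1 ×ˢ Icc (0 : ℝ) 1)
  rw [hbox]
  refine hpre.trans ?_
  rw [Measure.volume_eq_prod, ← Measure.prod_restrict,
    integral_fun_fst]
  simp [intervalIntegral.integral_of_le, integral_Icc_eq_integral_Ioc]

lemma isMagLine_singleton_iff {h : ℝ → ℝ} (p : Fin 2 → AddCircle (1 : ℝ)) :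
    IsMagLine 2 1 (shear h) {p} ↔ ∃ x, torusProj 2 1 x = p ∧ h (x 0) = 0 := by
  constructor
  · rintro ⟨γ, hγ, hs⟩
    have hproj : ∀ τ, torusProj 2 1 (γ τ) = p := fun τ => by
      have : torusProj 2 1 (γ τ) ∈ ({p} : Set (Fin 2 → AddCircle (1 : ℝ))) :=
        hs ▸ ⟨γ τ, ⟨τ, rfl⟩, rfl⟩
      simpa using this
    refine ⟨γ 0, hproj 0, ?_⟩
    have h0 : ∀ τ, HasDerivAt (fun τ => γ τ 0) 0 τ := fun τ => by
      simpa [shear] using (hasDerivAt_pi.1 (hγ τ)) 0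
    have h0c : ∀ τ, γ τ 0 = γ 0 0 := fun τ =>
      is_const_of_deriv_eq_zero (fun τ => (h0 τ).differentiableAt) (fun τ => (h0 τ).deriv) τ 0
    have h1 : ∀ τ, HasDerivAt (fun τ => γ τ 1 - h (γ 0 0) * τ) 0 τ := fun τ => by
      have h2 : HasDerivAt (fun τ => γ τ 1) (h (γ 0 0)) τ := by
        simpa [shear, h0c τ] using (hasDerivAt_pi.1 (hγ τ)) 1
      have h3 := h2.fun_sub ((hasDerivAt_id' τ).const_mul (h (γ 0 0)))
      rwa [mul_one, sub_self] at h3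
    have h1c : ∀ τ, γ τ 1 - h (γ 0 0) * τ = γ 0 1 - h (γ 0 0) * 0 := fun τ =>
      is_const_of_deriv_eq_zero (fun τ => (h1 τ).differentiableAt) (fun τ => (h1 τ).deriv) τ 0
    by_contra hne
    have h3 := h1c (1 / (2 * h (γ 0 0)))
    have h4 := congrFun ((hproj (1 / (2 * h (γ 0 0)))).trans (hproj 0).symm) 1
    simp only [torusProj] at h4
    rw [← sub_eq_zero, ← AddCircle.coe_sub, AddCircle.coe_eq_zero_iff] at h4
    obtain ⟨n, hn⟩ := h4
    have h5 : h (γ 0 0) * (1 / (2 * h (γ 0 0))) = 1 / 2 := by field_simp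
    have h6 : (2 * n : ℝ) = 1 := by
      rw [zsmul_one] at hn
      linarith
    have h7 : 2 * n = 1 := by exact_mod_cast h6
    omega
  · rintro ⟨x, rfl, hx⟩
    refine ⟨fun _ => x, fun τ => ?_, by simp⟩
    have : shear h x = 0 := by
      funext i
      fin_cases i <;> simp [shear, hx]
    rw [this]
    exact hasDerivAt_const τ x

/-- A homeomorphism of the torus cannot match the singular lines of two shear fields if the first
profile has finitely many, but at least three, zeros modulo `1`, and the second at most two. -/
lemma not_magLinesEquiv_shear {h k : ℝ → ℝ} {Z : Set (AddCircle (1 : ℝ))} (hZ : Z.Finite)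
    (hhZ : ∀ s, h s = 0 → (s : AddCircle (1 : ℝ)) ∈ Z)
    {c : Fin 3 → ℝ} (hc : Function.Injective fun i => (c i : AddCircle (1 : ℝ)))
    (hhc : ∀ i, h (c i) = 0) {d : Fin 2 → AddCircle (1 : ℝ)}
    (hk : ∀ s, k s = 0 → ∃ j, (s : AddCircle (1 : ℝ)) = d j) :
    ¬ MagLinesEquiv 2 1 (shear h) (shear k) := by
  rintro ⟨φ, hφ⟩
  have hsing : ∀ p, (∃ x, torusProj 2 1 x = p ∧ h (x 0) = 0) ↔
      ∃ x, torusProj 2 1 x = φ p ∧ k (x 0) = 0 := fun p => by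
    rw [← isMagLine_singleton_iff, ← isMagLine_singleton_iff, hφ, Set.image_singleton]
  have hex : ∀ i, ∃ j, φ (torusProj 2 1 ![c i, 0]) 0 = d j := fun i => by
    obtain ⟨x, hx, hkx⟩ := (hsing (torusProj 2 1 ![c i, 0])).1 ⟨_, rfl, by simpa using hhc i⟩
    rw [← hx]
    exact hk _ hkx
  choose f hf using hex
  obtain ⟨i, j, hij, hfij⟩ := Fintype.exists_ne_map_eq_of_card_lt f (by simp)
  obtain ⟨y, hy, hky⟩ := (hsing (torusProj 2 1 ![c i, 0])).1 ⟨_, rfl, by simpa using hhc i⟩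
  have hyd : (y 0 : AddCircle (1 : ℝ)) = d (f i) := by
    rw [← hf i, ← hy]
    rfl
  set C : Set (Fin 2 → AddCircle (1 : ℝ)) := {p | p 0 = d (f i)} with hC
  have hCrange : C = Set.range fun s : ℝ => torusProj 2 1 ![y 0, s] := by
    ext p
    constructor
    · intro hp
      obtain ⟨s, hs⟩ := QuotientAddGroup.mk_surjective (p 1)
      refine ⟨s, ?_⟩
      funext l
      fin_cases l
      · exact hyd.trans (Eq.symm hp)
      · exact hs
    · rintro ⟨s, rfl⟩
      exact hyd
  have hcont : Continuous fun s : ℝ => torusProj 2 1 ![y 0, s] := by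
    refine continuous_pi fun l => ?_
    fin_cases l
    · exact (continuous_const : Continuous fun _ : ℝ => (y 0 : AddCircle (1 : ℝ)))
    · exact (AddCircle.continuous_mk' 1 : Continuous fun s : ℝ => (s : AddCircle (1 : ℝ)))
  have hconn : IsPreconnected ((fun q => φ.symm q 0) '' C) := by
    rw [hCrange]
    refine (isPreconnected_range hcont).image _ ?_
    exact (by fun_prop : Continuous fun q => φ.symm q 0).continuousOn
  have hsub : (fun q => φ.symm q 0) '' C ⊆ Z := by
    rw [hCrange]
    rintro _ ⟨_, ⟨s, rfl⟩, rfl⟩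
    obtain ⟨x, hx, hhx⟩ := (hsing (φ.symm (torusProj 2 1 ![y 0, s]))).2
      ⟨![y 0, s], by simp, by simpa using hky⟩
    have := hhZ _ hhx
    simp only [← hx]
    exact this
  refine hij (hc (?_ : (c i : AddCircle (1 : ℝ)) = c j))
  by_contra hne
  refine hconn.infinite_of_nontrivial ⟨c i, ⟨φ (torusProj 2 1 ![c i, 0]), hf i, ?_⟩, c j,
    ⟨φ (torusProj 2 1 ![c j, 0]), (hf j).trans (by rw [hfij]), ?_⟩, hne⟩ (hZ.subset hsub)
  · simp [torusProj]
  · simp [torusProj]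

lemma contDiff_heatProfile (A μ T : ℝ) :
    ContDiff ℝ (⊤ : ℕ∞) fun p : ℝ × ℝ => heatProfile A μ T p.1 p.2 := by
  unfold heatProfile
  fun_prop

lemma hasDerivAt_heatProfile (A μ T t s : ℝ) :
    HasDerivAt (heatProfile A μ T t)
      (A * (exp (-(μ * t)) * (cos (2 * π * s) * (2 * π))
        + exp (3 * μ * T) / 2 * exp (-(4 * μ * t)) * (cos (4 * π * s) * (4 * π)))) s := by
  have h1 : ∀ a : ℝ, HasDerivAt (fun s => sin (a * s)) (cos (a * s) * a) s := fun a => by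
    simpa using ((hasDerivAt_id' s).const_mul a).sin
  exact (((h1 _).const_mul _).add ((h1 _).const_mul _)).const_mul _

lemma hasDerivAt_deriv_heatProfile (A μ T t s : ℝ) :
    HasDerivAt (deriv (heatProfile A μ T t))
      (A * (exp (-(μ * t)) * (-sin (2 * π * s) * (2 * π) * (2 * π))
        + exp (3 * μ * T) / 2 * exp (-(4 * μ * t)) *
          (-sin (4 * π * s) * (4 * π) * (4 * π)))) s := by
  have h1 : ∀ a : ℝ, HasDerivAt (fun s => cos (a * s) * a) (-sin (a * s) * a * a) s := fun a => by
    simpa using (((hasDerivAt_id' s).const_mul a).cos).mul_const a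
  rw [show deriv (heatProfile A μ T t) = _ from
    funext fun s => (hasDerivAt_heatProfile A μ T t s).deriv]
  exact (((h1 _).const_mul _).add ((h1 _).const_mul _)).const_mul _

lemma deriv_heatProfile_time (A η T t s : ℝ) :
    deriv (fun t => heatProfile A (4 * π ^ 2 * η) T t s) t
      = η * deriv (deriv (heatProfile A (4 * π ^ 2 * η) T t)) s := by
  rw [(hasDerivAt_deriv_heatProfile A _ T t s).deriv]
  have h1 : ∀ a : ℝ, HasDerivAt (fun t => exp (-(a * t))) (exp (-(a * t)) * -a) t := fun a => by
    simpa using ((hasDerivAt_id' t).const_mul a).neg.exp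
  refine (((((h1 _).mul_const _).add (((h1 _).const_mul _).mul_const _)).const_mul A).deriv).trans ?_
  ring

lemma heatProfile_add_one (A μ T t s : ℝ) :
    heatProfile A μ T t (s + 1) = heatProfile A μ T t s := by
  have h1 : sin (2 * π * (s + 1)) = sin (2 * π * s) := by
    rw [mul_add, mul_one, sin_add_two_pi]
  have h2 : sin (4 * π * (s + 1)) = sin (4 * π * s) := by
    rw [show 4 * π * (s + 1) = 4 * π * s + (2 : ℕ) * (2 * π) by push_cast; ring,
      sin_add_nat_mul_two_pi]
  simp only [heatProfile, h1, h2]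

lemma integral_sin_two_pi_mul_eq_zero {n : ℕ} (hn : n ≠ 0) :
    ∫ s in (0 : ℝ)..1, sin (n * (2 * π) * s) = 0 := by
  have h0 : (n * (2 * π) : ℝ) ≠ 0 := by positivity
  rw [intervalIntegral.integral_comp_mul_left (fun x => sin x) h0, integral_sin]
  simp [cos_nat_mul_two_pi]

lemma integral_heatProfile (A μ T t : ℝ) :
    ∫ s in (0 : ℝ)..1, heatProfile A μ T t s = 0 := by
  have h1 := integral_sin_two_pi_mul_eq_zero one_ne_zero
  have h2 := integral_sin_two_pi_mul_eq_zero two_ne_zero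
  rw [show ((1 : ℕ) * (2 * π) : ℝ) = 2 * π by push_cast; ring] at h1
  rw [show ((2 : ℕ) * (2 * π) : ℝ) = 4 * π by push_cast; ring] at h2
  unfold heatProfile
  rw [intervalIntegral.integral_const_mul, intervalIntegral.integral_add,
    intervalIntegral.integral_const_mul, intervalIntegral.integral_const_mul, h1, h2]
  · simp
  all_goals exact Continuous.intervalIntegrable (by fun_prop) _ _

lemma integral_heatProfile_sq_pos (μ T : ℝ) :
    0 < ∫ s in (0 : ℝ)..1, heatProfile 1 μ T 0 s ^ 2 := by
  have hc : Continuous (heatProfile 1 μ T 0) := by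
    unfold heatProfile
    fun_prop
  refine intervalIntegral.integral_pos one_pos (by fun_prop) (fun s _ => sq_nonneg _)
    ⟨1 / 4, by constructor <;> norm_num, ?_⟩
  have h1 : sin (2 * π * (1 / 4)) = 1 := by
    rw [show 2 * π * (1 / 4) = π / 2 by ring, sin_pi_div_two]
  have h2 : sin (4 * π * (1 / 4)) = 0 := by
    rw [show 4 * π * (1 / 4) = π by ring, sin_pi]
  simp [heatProfile, h1, h2, -one_div]

lemma sin_two_pi_mul_eq_zero {s : ℝ} (hs : sin (2 * π * s) = 0) :
    (s : AddCircle (1 : ℝ)) = (0 : ℝ) ∨ (s : AddCircle (1 : ℝ)) = (1 / 2 : ℝ) := by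
  obtain ⟨n, hn⟩ := sin_eq_zero_iff.1 hs
  have hn' : s = n / 2 := by
    have : (n : ℝ) = 2 * s := mul_right_cancel₀ pi_ne_zero (by linarith)
    linarith
  obtain ⟨m, rfl | rfl⟩ := n.even_or_odd'
  · left
    rw [← sub_eq_zero, ← AddCircle.coe_sub, AddCircle.coe_eq_zero_iff]
    exact ⟨m, by rw [hn', zsmul_one]; push_cast; ring⟩
  · right
    rw [← sub_eq_zero, ← AddCircle.coe_sub, AddCircle.coe_eq_zero_iff]
    exact ⟨m, by rw [hn', zsmul_one]; push_cast; ring⟩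

lemma cos_two_pi_mul_eq {s θ : ℝ} (hs : cos (2 * π * θ) = cos (2 * π * s)) :
    (s : AddCircle (1 : ℝ)) = θ ∨ (s : AddCircle (1 : ℝ)) = (-θ : ℝ) := by
  obtain ⟨n, hn | hn⟩ := cos_eq_cos_iff.1 hs
  · left
    rw [← sub_eq_zero, ← AddCircle.coe_sub, AddCircle.coe_eq_zero_iff]
    refine ⟨n, mul_left_cancel₀ two_pi_pos.ne' ?_⟩
    rw [zsmul_one]
    linarith
  · right
    rw [← sub_eq_zero, ← AddCircle.coe_sub, AddCircle.coe_eq_zero_iff]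
    refine ⟨n, mul_left_cancel₀ two_pi_pos.ne' ?_⟩
    rw [zsmul_one]
    linarith

lemma heatProfile_eq (A μ T t s : ℝ) :
    heatProfile A μ T t s = A * exp (-(μ * t)) * sin (2 * π * s)
      * (1 + exp (3 * μ * (T - t)) * cos (2 * π * s)) := by
  have h1 : exp (3 * μ * (T - t)) * exp (-(μ * t)) = exp (3 * μ * T) * exp (-(4 * μ * t)) := by
    rw [← exp_add, ← exp_add]
    ring_nf
  have h2 : sin (4 * π * s) = 2 * sin (2 * π * s) * cos (2 * π * s) := by
    rw [← sin_two_mul]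
    ring_nf
  rw [heatProfile, h2]
  linear_combination (-A * sin (2 * π * s) * cos (2 * π * s)) * h1

lemma not_magLinesEquiv_heatProfile {A μ T : ℝ} (hA : A ≠ 0) (hμ : 0 < μ) (hT : 0 < T) :
    ¬ MagLinesEquiv 2 1 (shear (heatProfile A μ T 0)) (shear (heatProfile A μ T T)) := by
  set a := exp (-(3 * μ * T)) with ha
  have ha0 : 0 < a := exp_pos _
  have ha1 : a < 1 := Real.exp_lt_one_iff.2 (by have := mul_pos hμ hT; linarith)
  have haE : exp (3 * μ * T) * a = 1 := by rw [ha, ← exp_add]; simp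
  set θ := arccos (-a) / (2 * π) with hθ
  have hθπ : 2 * π * θ = arccos (-a) := by
    rw [hθ]
    field_simp
  have hcosθ : cos (2 * π * θ) = -a := by
    rw [hθπ, cos_arccos (by linarith) (by linarith)]
  have hθ0 : 0 < θ := div_pos (arccos_pos.2 (by linarith)) two_pi_pos
  have hθ1 : θ < 1 / 2 := by
    have : arccos (-a) < π :=
      lt_of_le_of_ne (arccos_le_pi _) fun h => by
        have := arccos_eq_pi.1 h
        linarith
    rw [hθ, div_lt_iff₀ two_pi_pos]
    linarith
  refine not_magLinesEquiv_shear
    (Z := {((0 : ℝ) : AddCircle (1 : ℝ)), ((1 / 2 : ℝ) : AddCircle (1 : ℝ)),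
      (θ : AddCircle (1 : ℝ)), ((-θ : ℝ) : AddCircle (1 : ℝ))})
    (c := ![0, 1 / 2, θ])
    (d := ![((0 : ℝ) : AddCircle (1 : ℝ)), ((1 / 2 : ℝ) : AddCircle (1 : ℝ))])
    (Set.toFinite _) (fun s hs => ?_) (fun i j hij => ?_) (fun i => ?_) fun s hs => ?_
  · simp only [Set.mem_insert_iff, Set.mem_singleton_iff]
    rw [heatProfile_eq, sub_zero] at hs
    rcases mul_eq_zero.1 hs with hs | hs
    · have hs' : sin (2 * π * s) = 0 := by simpa [hA, exp_ne_zero] using hs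
      have := sin_two_pi_mul_eq_zero hs'
      tauto
    · have hs' : cos (2 * π * θ) = cos (2 * π * s) := by
        rw [hcosθ]
        refine mul_left_cancel₀ (exp_ne_zero (3 * μ * T)) ?_
        linarith
      have := cos_two_pi_mul_eq hs'
      tauto
  · have hmem : ∀ i : Fin 3, ![0, 1 / 2, θ] i ∈ Ico (0 : ℝ) (0 + 1) := by
      intro i
      fin_cases i
      · simp
      · constructor <;> norm_num
      · constructor <;> simp <;> linarith
    have h := (AddCircle.coe_eq_coe_iff_of_mem_Ico (hmem i) (hmem j)).1 hij
    fin_cases i <;> fin_cases j <;> simp at h ⊢ <;> linarith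
  · fin_cases i
    · simp [heatProfile]
    · have h1 : sin (2 * π * (1 / 2)) = 0 := by
        rw [show 2 * π * (1 / 2) = π by ring, sin_pi]
      simp only [heatProfile_eq]
      simp [h1, -one_div]
    · rw [heatProfile_eq, sub_zero]
      simp only [Fin.reduceFinMk, Matrix.cons_val]
      rw [hcosθ, mul_neg, haE]
      simp
  · rw [heatProfile_eq, sub_self, mul_zero, exp_zero, one_mul] at hs
    have hs' : sin (2 * π * s) = 0 := by
      rcases mul_eq_zero.1 hs with hs | hs
      · simpa [hA, exp_ne_zero] using hs
      · have h1 : cos (2 * π * s) = -1 := by linarith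
        have h2 := sin_sq_add_cos_sq (2 * π * s)
        rw [h1] at h2
        exact pow_eq_zero_iff two_ne_zero |>.1 (by linarith)
    rcases sin_two_pi_mul_eq_zero hs' with h | h
    · exact ⟨0, h⟩
    · exact ⟨1, h⟩

/-- The shear field driven by a solution of the heat equation solves the MHD system with zero
velocity and zero pressure. -/
lemma isMHD_shear_heatProfile (A ν η T : ℝ) :
    IsMHD 2 1 ν η (Set.Ici 0) (fun _ _ => 0)
      (fun t => shear (heatProfile A (4 * π ^ 2 * η) T t)) (fun _ _ => 0) := by
  set g := heatProfile A (4 * π ^ 2 * η) T with hg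
  have hd : ∀ t, Differentiable ℝ (g t) := fun t s =>
    (hasDerivAt_heatProfile A _ T t s).differentiableAt
  have hd2 : ∀ t, Differentiable ℝ (deriv (g t)) := fun t s =>
    (hasDerivAt_deriv_heatProfile A _ T t s).differentiableAt
  refine
    { smooth_u := contDiffOn_const
      smooth_b := ContDiff.contDiffOn (contDiff_pi.2 fun i => ?_)
      smooth_P := contDiffOn_const
      periodic_u := fun _ _ _ _ => rfl
      periodic_b := fun t _ x i => ?_
      periodic_P := fun _ _ _ _ => rfl
      div_u := fun _ _ x => by simp [divg, pd_const]
      div_b := fun t _ x => by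
        simp [divg, shear, pd_const, pd_comp_one (hd t)]
      momentum := fun t _ _ x i => ?_
      induction_eq := fun t _ _ x i => ?_ }
  · fin_cases i
    · exact contDiff_const
    · exact (contDiff_heatProfile A (4 * π ^ 2 * η) T).comp
        (f := fun p : ℝ × (Fin 2 → ℝ) => (p.1, p.2 0)) (by fun_prop)
  · fin_cases i <;> simp [shear, hg, heatProfile_add_one]
  · fin_cases i <;> simp [shear, pd_const, pd_comp_one (hd t)]
  · fin_cases i
    · simp [shear, pd_const]
    · simp [shear, pd_const, pd_comp_one (hd t), pd_comp_zero (hd t), pd_comp_zero (hd2 t)]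
      exact deriv_heatProfile_time A η T t (x 0)

/-- **Statement 0** (magnetic reconnection in 2D, Theorem 1.1 of the paper for `d = 2`).
For any viscosity `ν > 0`, resistivity `η > 0` and constants `T, M > 0` there are a smooth
zero-average divergence-free initial magnetic field `b₀` with `‖b₀‖_{L²} = M` and a global
smooth zero-average solution `(u, b, P)` of the MHD system on `𝕋² = ℝ²/ℤ²` with initial datum
`(0, b₀)` whose magnetic lines at times `0` and `T` are not topologically equivalent. -/
theorem magnetic_reconnection_2d (ν η T M : ℝ)
    (hν : 0 < ν) (hη : 0 < η) (hT : 0 < T) (hM : 0 < M) :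
    ∃ (u b : ℝ → (Fin 2 → ℝ) → Fin 2 → ℝ) (P : ℝ → (Fin 2 → ℝ) → ℝ),
      IsMHD 2 1 ν η (Set.Ici 0) u b P ∧
      ContDiff ℝ (⊤ : ℕ∞) (b 0) ∧
      (∀ x, u 0 x = 0) ∧
      L2norm 1 (b 0) = M ∧
      (∀ t : ℝ, 0 ≤ t → ZeroAvg 1 (u t) ∧ ZeroAvg 1 (b t)) ∧
      ¬ MagLinesEquiv 2 1 (b 0) (b T) := by
  set μ := 4 * π ^ 2 * η with hμ_def
  have hμ : 0 < μ := by positivity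
  set I := ∫ s in (0 : ℝ)..1, heatProfile 1 μ T 0 s ^ 2 with hI
  have hIpos : 0 < I := integral_heatProfile_sq_pos μ T
  have hA : M / √I ≠ 0 := (div_pos hM (sqrt_pos.2 hIpos)).ne'
  have hMHD := isMHD_shear_heatProfile (M / √I) ν η T
  refine ⟨_, _, _, hMHD, ?_, fun _ => rfl, ?_, fun t _ => ⟨fun i => by simp, fun i => ?_⟩,
    not_magLinesEquiv_heatProfile hA hμ hT⟩
  · refine contDiff_pi.2 fun i => ?_
    fin_cases i
    · exact contDiff_const
    · exact (contDiff_heatProfile (M / √I) μ T).comp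
        (f := fun x : Fin 2 → ℝ => ((0 : ℝ), x 0)) (by fun_prop)
  · have h1 : ∀ x : Fin 2 → ℝ, ∑ i, shear (heatProfile (M / √I) μ T 0) x i ^ 2
        = (M / √I) ^ 2 * heatProfile 1 μ T 0 (x 0) ^ 2 := fun x => by
      simp [shear, heatProfile, mul_pow]
    simp only [L2norm, ← hμ_def, h1]
    rw [integral_box_comp_zero (fun s => (M / √I) ^ 2 * heatProfile 1 μ T 0 s ^ 2),
      intervalIntegral.integral_const_mul, ← hI, div_pow, sq_sqrt hIpos.le,
      div_mul_cancel₀ _ hIpos.ne', sqrt_sq hM.le]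
  · fin_cases i
    · simp [shear]
    · exact (integral_box_comp_zero _).trans (integral_heatProfile _ _ _ _)

end
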